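/- For all nonnegative integers a, b, c, the following identity of quantum binomial coefficients holds in ℚ(v): Σ_{s=0}^{c} (−1)^s · binom(b+s, s) · binom(a+s, c) · binom(b+c+1, c−s) = binom(a−b−1, c). -/

import Mathlib

/-- The quantum integer `[n] = (v^n - v^{-n})/(v - v^{-1})` in `ℚ(v)`. -/
noncomputable def qint (n : ℤ) : RatFunc ℚ :=
  (RatFunc.X ^ n - RatFunc.X ^ (-n)) / (RatFunc.X - RatFunc.X⁻¹)

/-- The quantum factorial `[n]! = [n][n-1]⋯[1]`, with `[0]! = 1`. -/
noncomputable def qfact (n : ℕ) : RatFunc ℚ :=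
  ∏ i ∈ Finset.range n, qint (i + 1)

/-- The quantum binomial coefficient `binom(n, k) = [n][n-1]⋯[n-k+1]/[k]!`
for `n : ℤ` and `k : ℕ`. -/
noncomputable def qbinom (n : ℤ) (k : ℕ) : RatFunc ℚ :=
  (∏ i ∈ Finset.range k, qint (n - i)) / qfact k

lemma X_zpow_ne_one (n : ℤ) (hn : n ≠ 0) : (RatFunc.X : RatFunc ℚ) ^ n ≠ 1 := by
  have key : ∀ m : ℕ, m ≠ 0 → (RatFunc.X : RatFunc ℚ) ^ m ≠ 1 := by
    intro m hm h
    rw [← RatFunc.algebraMap_X, ← map_pow, ← map_one (algebraMap (Polynomial ℚ) (RatFunc ℚ))] at h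
    have h2 := RatFunc.algebraMap_injective ℚ h
    have h3 := congrArg Polynomial.natDegree h2
    simp at h3
    exact hm h3
  intro h
  rcases Int.eq_nat_or_neg n with ⟨m, rfl | rfl⟩
  · exact key m (by omega) (by simpa using h)
  · exact key m (by omega) (by simpa using h)

lemma X_zpow_inj {m n : ℤ} (h : (RatFunc.X : RatFunc ℚ) ^ m = RatFunc.X ^ n) : m = n := by
  by_contra hne
  apply X_zpow_ne_one (m - n) (sub_ne_zero.mpr hne)
  rw [zpow_sub₀ RatFunc.X_ne_zero, h, div_self (zpow_ne_zero _ RatFunc.X_ne_zero)]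

lemma D_ne_zero : (RatFunc.X : RatFunc ℚ) - RatFunc.X⁻¹ ≠ 0 := by
  intro h
  have h2 : (RatFunc.X : RatFunc ℚ) ^ (1 : ℤ) = RatFunc.X ^ (-1 : ℤ) := by
    simpa using sub_eq_zero.mp h
  have := X_zpow_inj h2
  omega

lemma qint_ne_zero {n : ℤ} (hn : n ≠ 0) : qint n ≠ 0 := by
  unfold qint
  refine div_ne_zero (fun h => hn ?_) D_ne_zero
  have := X_zpow_inj (sub_eq_zero.mp h)
  omega

lemma qint_neg (n : ℤ) : qint (-n) = - qint n := by
  unfold qint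
  rw [neg_neg]
  ring

lemma qint_sub (x y : ℤ) : qint (x - y) =
    (RatFunc.X ^ (2 * x) - RatFunc.X ^ (2 * y)) /
      (RatFunc.X ^ x * (RatFunc.X ^ y * (RatFunc.X - RatFunc.X⁻¹))) := by
  have hX : (RatFunc.X : RatFunc ℚ) ≠ 0 := RatFunc.X_ne_zero
  have hx := zpow_ne_zero x hX
  have hy := zpow_ne_zero y hX
  have hD := D_ne_zero
  unfold qint
  rw [neg_sub, zpow_sub₀ hX, zpow_sub₀ hX, two_mul, two_mul, zpow_add₀ hX, zpow_add₀ hX,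
    div_eq_div_iff hD (mul_ne_zero hx (mul_ne_zero hy hD))]
  generalize (RatFunc.X : RatFunc ℚ) - RatFunc.X⁻¹ = D at *
  field_simp

lemma lagrange_field {K : Type*} [Field K] (c : ℕ) (y x : ℕ → K)
    (hx : Function.Injective x) (t : K) :
    ∏ i ∈ Finset.range c, (t - y i) = ∑ s ∈ Finset.range (c + 1),
      (∏ i ∈ Finset.range c, (x s - y i)) *
        ∏ j ∈ (Finset.range (c + 1)).erase s, ((t - x j) / (x s - x j)) := by
  classical
  let f : Polynomial K := ∏ i ∈ Finset.range c, (Polynomial.X - Polynomial.C (y i))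
  have hdeg : f.degree < (Finset.range (c + 1)).card := by
    simp only [f, Polynomial.degree_prod, Polynomial.degree_X_sub_C]
    simp
    exact_mod_cast Nat.lt_succ_self c
  have h := Lagrange.eq_interpolate (s := Finset.range (c + 1)) (v := x) (f := f)
    hx.injOn hdeg
  have h2 := congrArg (Polynomial.eval t) h
  simp only [Lagrange.interpolate_apply, Polynomial.eval_finsetSum, Lagrange.basis,
    Lagrange.basisDivisor, f, Polynomial.eval_prod, Polynomial.eval_mul, Polynomial.eval_sub,
    Polynomial.eval_X, Polynomial.eval_C] at h2
  rw [h2]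
  refine Finset.sum_congr rfl fun s _ => ?_
  congr 1
  refine Finset.prod_congr rfl fun j _ => ?_
  rw [div_eq_mul_inv, mul_comm]

lemma lagrange_qint (c : ℕ) (y x : ℕ → ℤ) (hx : Function.Injective x) (t : ℤ) :
    ∏ i ∈ Finset.range c, qint (t - y i) = ∑ s ∈ Finset.range (c + 1),
      (∏ i ∈ Finset.range c, qint (x s - y i)) *
        ∏ j ∈ (Finset.range (c + 1)).erase s, (qint (t - x j) / qint (x s - x j)) := by
  have hX : (RatFunc.X : RatFunc ℚ) ≠ 0 := RatFunc.X_ne_zero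
  have hz : ∀ n : ℤ, (RatFunc.X : RatFunc ℚ) ^ n ≠ 0 := fun n => zpow_ne_zero n hX
  have hD := D_ne_zero
  have h := lagrange_field c (fun i => (RatFunc.X : RatFunc ℚ) ^ (2 * y i))
    (fun i => (RatFunc.X : RatFunc ℚ) ^ (2 * x i))
    (fun i j hij => hx (by have := X_zpow_inj hij; omega)) (RatFunc.X ^ (2 * t))
  have hfac : ∀ z : ℤ, ∏ i ∈ Finset.range c, qint (z - y i) =
      (∏ i ∈ Finset.range c, ((RatFunc.X : RatFunc ℚ) ^ (2 * z) - RatFunc.X ^ (2 * y i))) /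
        ((RatFunc.X ^ z) ^ c *
        ∏ i ∈ Finset.range c, (RatFunc.X ^ (y i) * (RatFunc.X - RatFunc.X⁻¹))) := by
    intro z
    simp only [qint_sub, Finset.prod_div_distrib, Finset.prod_mul_distrib, Finset.prod_const,
      Finset.card_range]
  rw [hfac t, h, Finset.sum_div]
  refine Finset.sum_congr rfl fun s hs => ?_
  rw [hfac (x s)]
  have hP : ∏ j ∈ (Finset.range (c + 1)).erase s, (qint (t - x j) / qint (x s - x j)) =
      (∏ j ∈ (Finset.range (c + 1)).erase s,
        (((RatFunc.X : RatFunc ℚ) ^ (2 * t) - RatFunc.X ^ (2 * x j)) /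
          (RatFunc.X ^ (2 * x s) - RatFunc.X ^ (2 * x j)))) *
        ((RatFunc.X ^ (x s)) / (RatFunc.X ^ t)) ^ c := by
    have hc : ((Finset.range (c + 1)).erase s).card = c := by
      rw [Finset.card_erase_of_mem hs]; simp
    have hpc : ∀ z : RatFunc ℚ, z ^ c = ∏ _j ∈ (Finset.range (c + 1)).erase s, z := by
      intro z
      rw [Finset.prod_const, hc]
    rw [hpc, ← Finset.prod_mul_distrib]
    refine Finset.prod_congr rfl fun j hj => ?_
    have hne : (RatFunc.X : RatFunc ℚ) ^ (2 * x s) - RatFunc.X ^ (2 * x j) ≠ 0 := by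
      intro h0
      have h1 := X_zpow_inj (sub_eq_zero.mp h0)
      exact (Finset.ne_of_mem_erase hj) (hx (by omega))
    rw [qint_sub, qint_sub]
    have h1 := hz t
    have h2 := hz (x s)
    have h3 := hz (x j)
    generalize (RatFunc.X : RatFunc ℚ) - RatFunc.X⁻¹ = D at *
    generalize (RatFunc.X : RatFunc ℚ) ^ (2 * x s) - RatFunc.X ^ (2 * x j) = E at *
    generalize (RatFunc.X : RatFunc ℚ) ^ (2 * t) - RatFunc.X ^ (2 * x j) = F at *
    generalize (RatFunc.X : RatFunc ℚ) ^ t = T at *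
    generalize (RatFunc.X : RatFunc ℚ) ^ (x s) = S at *
    generalize (RatFunc.X : RatFunc ℚ) ^ (x j) = J at *
    field_simp
  rw [hP, div_pow]
  have h1 := pow_ne_zero c (hz t)
  have h2 := pow_ne_zero c (hz (x s))
  have h3 : ∏ i ∈ Finset.range c,
      ((RatFunc.X : RatFunc ℚ) ^ (y i) * (RatFunc.X - RatFunc.X⁻¹)) ≠ 0 :=
    Finset.prod_ne_zero_iff.mpr fun i _ => mul_ne_zero (hz _) hD
  generalize ∏ i ∈ Finset.range c,
      ((RatFunc.X : RatFunc ℚ) ^ (y i) * (RatFunc.X - RatFunc.X⁻¹)) = Q at *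
  generalize ((RatFunc.X : RatFunc ℚ) ^ t) ^ c = T at *
  generalize ((RatFunc.X : RatFunc ℚ) ^ (x s)) ^ c = S at *
  field_simp

lemma prod_erase_split (f : ℕ → RatFunc ℚ) (s k : ℕ) :
    ∏ j ∈ (Finset.range (s + k + 1)).erase s, f j =
      (∏ j ∈ Finset.range s, f j) * ∏ j ∈ Finset.range k, f (s + 1 + j) := by
  have h : (Finset.range (s + k + 1)).erase s =
      Finset.range s ∪ (Finset.range k).image (fun j => s + 1 + j) := by
    ext j
    simp only [Finset.mem_erase, Finset.mem_range, Finset.mem_union, Finset.mem_image]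
    constructor
    · rintro ⟨h1, h2⟩
      rcases lt_or_gt_of_ne h1 with h | h
      · exact Or.inl h
      · exact Or.inr ⟨j - s - 1, by omega, by omega⟩
    · rintro (h | ⟨i, h1, h2⟩) <;> omega
  rw [h, Finset.prod_union, Finset.prod_image]
  · intro i _ j _ hij
    simpa using hij
  · rw [Finset.disjoint_left]
    intro j h1 h2
    simp only [Finset.mem_range, Finset.mem_image] at h1 h2
    obtain ⟨i, _, h3⟩ := h2
    omega

lemma coeff_eq (b s k : ℕ) :
    ∏ j ∈ (Finset.range (s + k + 1)).erase s,
      (qint ((-(b : ℤ) - 1) - (j : ℤ)) / qint ((s : ℤ) - (j : ℤ))) =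
    (-1 : RatFunc ℚ) ^ s * qbinom ((b : ℤ) + s) s * qbinom ((b : ℤ) + (s + k : ℕ) + 1) k := by
  rw [prod_erase_split, Finset.prod_div_distrib, Finset.prod_div_distrib]
  have e1 : ∏ j ∈ Finset.range s, qint ((-(b : ℤ) - 1) - (j : ℤ)) =
      (-1) ^ s * ∏ i ∈ Finset.range s, qint ((b : ℤ) + s - i) := by
    rw [← Finset.prod_range_reflect (fun i : ℕ => qint ((b : ℤ) + s - i))]
    conv_rhs => rw [← Finset.card_range s, ← Finset.prod_const, Finset.card_range,
      ← Finset.prod_mul_distrib]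
    refine Finset.prod_congr rfl fun j hj => ?_
    have := Finset.mem_range.mp hj
    rw [neg_one_mul, ← qint_neg]
    congr 1
    omega
  have e2 : ∏ j ∈ Finset.range s, qint ((s : ℤ) - (j : ℤ)) = qfact s := by
    unfold qfact
    rw [← Finset.prod_range_reflect (fun i : ℕ => qint ((i : ℤ) + 1))]
    refine Finset.prod_congr rfl fun j hj => ?_
    have := Finset.mem_range.mp hj
    congr 1
    omega
  have e3 : ∏ j ∈ Finset.range k, qint ((-(b : ℤ) - 1) - ((s + 1 + j : ℕ) : ℤ)) =
      (-1) ^ k * ∏ i ∈ Finset.range k, qint ((b : ℤ) + (s + k : ℕ) + 1 - i) := by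
    rw [← Finset.prod_range_reflect (fun i : ℕ => qint ((b : ℤ) + (s + k : ℕ) + 1 - i))]
    conv_rhs => rw [← Finset.card_range k, ← Finset.prod_const, Finset.card_range,
      ← Finset.prod_mul_distrib]
    refine Finset.prod_congr rfl fun j hj => ?_
    have := Finset.mem_range.mp hj
    rw [neg_one_mul, ← qint_neg]
    congr 1
    omega
  have e4 : ∏ j ∈ Finset.range k, qint ((s : ℤ) - ((s + 1 + j : ℕ) : ℤ)) =
      (-1) ^ k * qfact k := by
    unfold qfact
    conv_rhs => rw [← Finset.card_range k, ← Finset.prod_const, Finset.card_range,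
      ← Finset.prod_mul_distrib]
    refine Finset.prod_congr rfl fun j hj => ?_
    rw [neg_one_mul, ← qint_neg]
    congr 1
    push_cast
    ring
  rw [e1, e2, e3, e4, mul_div_mul_left _ _ (pow_ne_zero k (neg_ne_zero.mpr one_ne_zero))]
  unfold qbinom
  ring

/-- For all nonnegative integers `a, b, c`:
`Σ_{s=0}^{c} (-1)^s binom(b+s, s) binom(a+s, c) binom(b+c+1, c-s) = binom(a-b-1, c)`. -/
theorem quantum_triple_binomial_identity (a b c : ℕ) :
    ∑ s ∈ Finset.range (c + 1),
        (-1 : RatFunc ℚ) ^ s * qbinom ((b : ℤ) + s) s * qbinom ((a : ℤ) + s) c *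
          qbinom ((b : ℤ) + c + 1) (c - s)
      = qbinom ((a : ℤ) - b - 1) c := by
  have h := lagrange_qint c (fun i => (i : ℤ) - a) (fun j => (j : ℤ)) Nat.cast_injective
    (-(b : ℤ) - 1)
  have e : qbinom ((a : ℤ) - b - 1) c =
      (∏ i ∈ Finset.range c, qint ((-(b : ℤ) - 1) - ((i : ℤ) - a))) / qfact c := by
    unfold qbinom
    congr 1
    refine Finset.prod_congr rfl fun i _ => ?_
    congr 1
    ring
  rw [e, h, Finset.sum_div]
  refine Finset.sum_congr rfl fun s hs => ?_
  obtain ⟨k, rfl⟩ := Nat.exists_eq_add_of_le (Nat.lt_succ_iff.mp (Finset.mem_range.mp hs))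
  rw [coeff_eq, Nat.add_sub_cancel_left]
  have e2 : ∏ i ∈ Finset.range (s + k), qint ((s : ℤ) - ((i : ℤ) - a)) =
      ∏ i ∈ Finset.range (s + k), qint ((a : ℤ) + s - i) := by
    refine Finset.prod_congr rfl fun i _ => ?_
    congr 1
    ring
  rw [e2]
  have e3 : qbinom ((a : ℤ) + s) (s + k) =
    (∏ i ∈ Finset.range (s + k), qint ((a : ℤ) + s - i)) / qfact (s + k) := rfl
  rw [e3]
  ring
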